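/- Let M be an N×N complex matrix whose Hermitian part (M + M*)/2 is positive definite. Then the complex Gaussian integral over ℂ^N (with Lebesgue measure, identifying ℂ^N with ℝ^{2N}) satisfies ∫_{ℂ^N} exp(−∑_{i,j} conj(S_i) M_{ij} S_j) dS = π^N / det M. In particular det M ≠ 0 and the integral is absolutely convergent. -/

import Mathlib

open MeasureTheory Matrix
open scoped ComplexOrder

noncomputable section


open scoped MatrixOrder Matrix.Norms.L2Operator in
theorem cgi_decomp (N : ℕ) (M : Matrix (Fin N) (Fin N) ℂ)
    (hM : ((1 / 2 : ℂ) • (M + Mᴴ)).PosDef) :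
    ∃ (P : Matrix (Fin N) (Fin N) ℂ) (d : Fin N → ℂ), P.det ≠ 0 ∧ (∀ i, (d i).re = 1) ∧
      M = Pᴴ * diagonal d * P := by
  obtain ⟨B, hB, hHB⟩ := CStarAlgebra.isStrictlyPositive_iff_eq_star_mul_self.mp
    hM.isStrictlyPositive
  have hBdet : IsUnit B.det := (Matrix.isUnit_iff_isUnit_det B).mp hB
  rw [star_eq_conjTranspose] at hHB
  set K : Matrix (Fin N) (Fin N) ℂ := (-Complex.I / 2) • (M - Mᴴ) with hK
  have hKh : K.IsHermitian := by
    ext i j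
    simp only [hK, conjTranspose_apply, Matrix.smul_apply, Matrix.sub_apply, star_smul, star_sub, star_star,
      smul_eq_mul]
    simp
    ring
  have hX : ((B⁻¹)ᴴ * K * B⁻¹).IsHermitian := by
    unfold Matrix.IsHermitian
    rw [conjTranspose_mul, conjTranspose_mul, conjTranspose_conjTranspose, hKh.eq, mul_assoc]
  have hs := hX.spectral_theorem
  rw [Unitary.conjStarAlgAut_apply] at hs
  set U : Matrix (Fin N) (Fin N) ℂ := (hX.eigenvectorUnitary : Matrix (Fin N) (Fin N) ℂ) with hU
  have hUU : U * star U = 1 := Unitary.coe_mul_star_self hX.eigenvectorUnitary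
  rw [star_eq_conjTranspose] at hs hUU
  set L : Matrix (Fin N) (Fin N) ℂ := diagonal (RCLike.ofReal ∘ hX.eigenvalues) with hL
  refine ⟨Uᴴ * B, fun i => 1 + Complex.I * (hX.eigenvalues i : ℂ), ?_, ?_, ?_⟩
  · rw [det_mul]
    refine mul_ne_zero ?_ hBdet.ne_zero
    have := congrArg Matrix.det hUU
    rw [det_mul, det_one] at this
    exact right_ne_zero_of_mul_eq_one this
  · intro i; simp
  · have hD : diagonal (fun i => 1 + Complex.I * (hX.eigenvalues i : ℂ)) = 1 + Complex.I • L := by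
      ext i j
      by_cases h : i = j
      · subst h; simp [hL]
      · simp [hL, h]
    have h1 : B⁻¹ * B = 1 := nonsing_inv_mul B hBdet
    have h2 : Bᴴ * (B⁻¹)ᴴ = 1 := by rw [← conjTranspose_mul, h1, conjTranspose_one]
    have hKB : Bᴴ * (U * L * Uᴴ) * B = K := by
      rw [← hs]
      calc Bᴴ * ((B⁻¹)ᴴ * K * B⁻¹) * B = (Bᴴ * (B⁻¹)ᴴ) * K * (B⁻¹ * B) := by
            simp only [mul_assoc]
        _ = K := by rw [h1, h2, one_mul, mul_one]
    rw [hD, conjTranspose_mul, conjTranspose_conjTranspose]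
    have : Bᴴ * U * (1 + Complex.I • L) * (Uᴴ * B)
        = Bᴴ * (U * Uᴴ) * B + Complex.I • (Bᴴ * (U * L * Uᴴ) * B) := by
      simp only [mul_add, add_mul, mul_one, mul_assoc, mul_smul_comm, smul_mul_assoc]
    rw [this, hUU, mul_one, ← hHB, hKB, hK]
    ext i j
    simp only [Matrix.add_apply, Matrix.smul_apply, Matrix.sub_apply, smul_eq_mul]
    linear_combination ((1/2) * (M i j - Mᴴ i j)) * (Complex.I_mul_I)

theorem cgi_int1 (d : ℂ) (hd : d.re = 1) :
    Integrable (fun z : ℂ => Complex.exp (-d * (‖z‖ : ℂ) ^ 2)) := by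
  have h := GaussianFourier.integrable_cexp_neg_mul_sq_norm_add (V := ℂ) (b := d)
    (by rw [hd]; exact one_pos) 0 0
  simpa using h

theorem cgi_val1 (d : ℂ) (hd : d.re = 1) :
    ∫ z : ℂ, Complex.exp (-d * (‖z‖ : ℂ) ^ 2) = Real.pi / d := by
  have h := GaussianFourier.integral_cexp_neg_mul_sq_norm (V := ℂ) (b := d)
    (by rw [hd]; exact one_pos)
  rw [h, Complex.finrank_real_complex]
  simp

theorem cgi_quad (N : ℕ) (P : Matrix (Fin N) (Fin N) ℂ) (d : Fin N → ℂ) (S : Fin N → ℂ) :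
    ∑ i : Fin N, ∑ j : Fin N, (starRingEnd ℂ) (S i) * (Pᴴ * diagonal d * P) i j * S j
      = ∑ k, d k * (‖(P *ᵥ S) k‖ : ℂ) ^ 2 := by
  have h1 : ∑ i : Fin N, ∑ j : Fin N, (starRingEnd ℂ) (S i) * (Pᴴ * diagonal d * P) i j * S j
      = star S ⬝ᵥ ((Pᴴ * diagonal d * P) *ᵥ S) := by
    simp [dotProduct, mulVec, Finset.mul_sum, mul_assoc]
  rw [h1, ← mulVec_mulVec, ← mulVec_mulVec, dotProduct_mulVec, ← star_mulVec]
  simp only [dotProduct, mulVec_diagonal, Pi.star_apply]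
  refine Finset.sum_congr rfl fun k _ => ?_
  rw [← Complex.conj_mul', RCLike.star_def]
  ring

/-- if the Hermitian part `(M + M*)/2` of a complex `N × N`
matrix `M` is positive definite, then `det M ≠ 0`, the complex Gaussian
`exp(-S* M S)` is absolutely integrable over `ℂ^N` (with Lebesgue measure),
and `∫_{ℂ^N} exp(-S* M S) dS = π^N / det M`. -/
theorem complex_gaussian_integral (N : ℕ) (M : Matrix (Fin N) (Fin N) ℂ)
    (hM : ((1 / 2 : ℂ) • (M + Mᴴ)).PosDef) :
    M.det ≠ 0 ∧
    Integrable (fun S : Fin N → ℂ =>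
      Complex.exp (-∑ i : Fin N, ∑ j : Fin N,
        (starRingEnd ℂ) (S i) * M i j * S j)) ∧
    ∫ S : Fin N → ℂ,
        Complex.exp (-∑ i : Fin N, ∑ j : Fin N,
          (starRingEnd ℂ) (S i) * M i j * S j)
      = (Real.pi : ℂ) ^ N / M.det := by
  obtain ⟨P, d, hP, hd, hMP⟩ := cgi_decomp N M hM
  have hd0 : ∀ i, d i ≠ 0 := fun i h => by have := hd i; simp [h] at this
  have hdetM : M.det = (Complex.normSq P.det : ℂ) * ∏ i, d i := by
    rw [hMP, det_mul, det_mul, det_diagonal, det_conjTranspose, Complex.normSq_eq_conj_mul_self,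
      RCLike.star_def]
    ring
  have hn : Complex.normSq P.det ≠ 0 := by simpa using hP
  set f : (Fin N → ℂ) →ₗ[ℝ] (Fin N → ℂ) := (Matrix.toLin' P).restrictScalars ℝ with hf
  have hfdet : LinearMap.det f = Complex.normSq P.det := by
    rw [hf, LinearMap.det_restrictScalars, LinearMap.det_toLin', Algebra.norm_complex_eq]
    rfl
  have hmap := Measure.map_linearMap_addHaar_eq_smul_addHaar
    (volume : Measure (Fin N → ℂ)) (f := f) (by rw [hfdet]; exact hn)
  rw [hfdet] at hmap
  have hfm : Measurable f := f.continuous_of_finiteDimensional.measurable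
  set g : (Fin N → ℂ) → ℂ := fun S => ∏ k, Complex.exp (-d k * (‖S k‖ : ℂ) ^ 2) with hg
  have hgi : Integrable g := Integrable.fintype_prod (fun k => cgi_int1 (d k) (hd k))
  have hgv : ∫ S, g S = ∏ k, ((Real.pi : ℂ) / d k) := by
    rw [hg, integral_fintype_prod_volume_eq_prod
      (fun k (z : ℂ) => Complex.exp (-d k * (‖z‖ : ℂ) ^ 2))]
    exact Finset.prod_congr rfl fun k _ => cgi_val1 (d k) (hd k)
  have hgm : Integrable g (Measure.map f volume) := by
    rw [hmap]; exact hgi.smul_measure ENNReal.ofReal_ne_top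
  have heq : (fun S : Fin N → ℂ => Complex.exp (-∑ i : Fin N, ∑ j : Fin N,
        (starRingEnd ℂ) (S i) * M i j * S j)) = g ∘ f := by
    funext S
    rw [hMP, cgi_quad, ← Finset.sum_neg_distrib, Complex.exp_sum]
    simp [hg, hf]
  refine ⟨?_, ?_, ?_⟩
  · rw [hdetM]
    exact mul_ne_zero (by exact_mod_cast hn) (Finset.prod_ne_zero_iff.mpr fun i _ => hd0 i)
  · rw [heq]
    exact (integrable_map_measure hgm.aestronglyMeasurable hfm.aemeasurable).mp hgm
  · rw [heq]
    have := integral_map hfm.aemeasurable hgm.aestronglyMeasurable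
    change ∫ S, g (f S) = _
    rw [← this, hmap, integral_smul_measure, hgv, hdetM, Finset.prod_div_distrib,
      ENNReal.toReal_ofReal (abs_nonneg _),
      abs_of_nonneg (inv_nonneg.mpr (Complex.normSq_nonneg _)), Complex.real_smul]
    simp only [Finset.prod_const, Finset.card_univ, Fintype.card_fin, Complex.ofReal_inv]
    rw [div_eq_mul_inv, div_eq_mul_inv, mul_inv]
    ring
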